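/- arXiv:2012.15325 — 3 statements merged into one kernel-verified Lean document; each statement's English description precedes it below -/
import Mathlib

section
/- For all real numbers a > 0, b > 0, δ > 0 and r > 1, one has a/b ≥ r·δ^{r/(r-1)}·a^{1/r} − (r−1)·δ^{r²/(r−1)²}·b^{1/(r−1)}. -/
/-- Reverse Young inequality (Lemma 3.1). -/
theorem reverse_young (a b δ r : ℝ) (ha : 0 < a) (hb : 0 < b) (hδ : 0 < δ) (hr : 1 < r) :
    a / b ≥ r * δ ^ (r / (r - 1)) * a ^ (1 / r)
      - (r - 1) * δ ^ (r ^ 2 / (r - 1) ^ 2) * b ^ (1 / (r - 1)) := by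
  have hr0 : 0 < r := by linarith
  have hr1 : 0 < r - 1 := by linarith
  have hne : r ≠ 0 := hr0.ne'
  have hne1 : r - 1 ≠ 0 := hr1.ne'
  have hab : 0 < a / b := div_pos ha hb
  have hpq : r.HolderConjugate (r / (r - 1)) := by
    rw [Real.holderConjugate_iff]
    refine ⟨hr, ?_⟩
    field_simp
    ring
  have hd : 0 ≤ δ ^ (r / (r - 1)) := by positivity
  have hb' : 0 ≤ b ^ (1 / r) := by positivity
  have h := Real.young_inequality_of_nonneg (a := (a / b) ^ (1 / r))
    (b := δ ^ (r / (r - 1)) * b ^ (1 / r)) (by positivity) (by positivity) hpq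
  have e1 : ((a / b) ^ (1 / r)) ^ r = a / b := by
    rw [← Real.rpow_mul hab.le, one_div_mul_cancel hne, Real.rpow_one]
  have e2 : (δ ^ (r / (r - 1)) * b ^ (1 / r)) ^ (r / (r - 1))
      = δ ^ (r ^ 2 / (r - 1) ^ 2) * b ^ (1 / (r - 1)) := by
    rw [Real.mul_rpow hd hb', ← Real.rpow_mul hδ.le, ← Real.rpow_mul hb.le]
    congr 2 <;> field_simp
  have e3 : (a / b) ^ (1 / r) * (δ ^ (r / (r - 1)) * b ^ (1 / r))
      = δ ^ (r / (r - 1)) * a ^ (1 / r) := by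
    have : a ^ (1 / r) = (a / b) ^ (1 / r) * b ^ (1 / r) := by
      rw [← Real.mul_rpow hab.le hb.le, div_mul_cancel₀ _ hb.ne']
    rw [this]
    ring
  rw [e1, e2, e3] at h
  have h2 := mul_le_mul_of_nonneg_left h hr0.le
  have e4 : ∀ x y : ℝ, r * (x / r + y / (r / (r - 1))) = x + (r - 1) * y := by
    intro x y
    field_simp
  rw [e4] at h2
  linarith
end

section
/- Let Q be a set, V : Q → ℝ, L : [0,T] × Q → ℝ, D : Q × Q → [0, +∞], and define I(t,q) := V(q) − L(t,q). Let 0 ≤ t₀ < t₁ < ⋯ < t_N ≤ T and q₀, q₁, …, q_N ∈ Q be such that for each k = 1, …, N the stability inequality I(t_{k−1}, q_{k−1}) ≤ I(t_{k−1}, q_k) + D(q_{k−1}, q_k) holds. Then Σ_{k=1}^{N} [L(t_{k−1}, q_k) − L(t_k, q_k)] ≤ I(t_N, q_N) − I(t₀, q₀) + Σ_{k=1}^{N} D(q_{k−1}, q_k). -/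
open scoped ENNReal

/-- Lower discrete energy estimate: testing the stability of `q_{k-1}` with `q_k` and
summing gives `Σ [L(t_{k-1}, q_k) - L(t_k, q_k)] ≤ I(t_N, q_N) - I(t_0, q_0) + Σ D(q_{k-1}, q_k)`,
where `I(t,q) = V(q) - L(t,q)`. -/
theorem discrete_lower_energy_estimate {Q : Type*} (T : ℝ) (V : Q → ℝ)
    (L : ℝ → Q → ℝ) (D : Q → Q → ℝ≥0∞)
    (I : ℝ → Q → ℝ) (hI : ∀ s p, I s p = V p - L s p)
    (N : ℕ) (t : ℕ → ℝ) (q : ℕ → Q)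
    (ht0 : 0 ≤ t 0) (htT : t N ≤ T) (hmono : ∀ k < N, t k < t (k + 1))
    (hstab : ∀ k < N,
      (I (t k) (q k) : EReal) ≤ (I (t k) (q (k + 1)) : EReal) + (D (q k) (q (k + 1)) : EReal)) :
    ((∑ k ∈ Finset.range N, (L (t k) (q (k + 1)) - L (t (k + 1)) (q (k + 1))) : ℝ) : EReal) ≤
      ((I (t N) (q N) - I (t 0) (q 0) : ℝ) : EReal) +
        ((∑ k ∈ Finset.range N, D (q k) (q (k + 1)) : ℝ≥0∞) : EReal) := by
  clear ht0 htT hmono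
  induction N with
  | zero => simp
  | succ n ih =>
    have h1 := ih (fun k hk => hstab k (Nat.lt_succ_of_lt hk))
    have h2 := hstab n (Nat.lt_succ_self n)
    have h3 := add_le_add_right h2 (((L (t n) (q (n + 1)) - L (t (n + 1)) (q (n + 1)))
      - I (t n) (q n) : ℝ) : EReal)
    rw [← add_assoc, ← EReal.coe_add, ← EReal.coe_add] at h3
    have h4 := add_le_add h1 h3
    rw [Finset.sum_range_succ, Finset.sum_range_succ, EReal.coe_ennreal_add]
    rw [← EReal.coe_add, add_add_add_comm, ← EReal.coe_add] at h4
    convert h4 using 2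
    · congr 1
      ring
    · congr 1
      simp only [hI]
      ring
end

section
/- (Generalized Helly selection principle.) Let Z be a Banach space, K ⊂ Z a weakly sequentially compact subset, and D : Z × Z → [0, +∞] such that: (i) D is sequentially weakly lower semicontinuous, i.e. D(z, z̃) ≤ liminf_k D(z_k, z̃_k) whenever z_k ⇀ z and z̃_k ⇀ z̃; (ii) positivity: if {z_k} ⊂ Z is bounded and min{D(z_k, z), D(z, z_k)} → 0, then z_k ⇀ z; (iii) D(z₁, z₂) = 0 if and only if z₁ = z₂; (iv) D satisfies the triangle inequality D(z₁, z₃) ≤ D(z₁, z₂) + D(z₂, z₃). Then for every C > 0 and every sequence of functions z_k : [0,T] → K with sup_k Var(D, z_k; [0,T]) < C, there exist a subsequence (not relabeled), a function z : [0,T] → K, and a nondecreasing function Δ : [0,T] → [0, C] such that: (1) Var(D, z_k; [0,t]) → Δ(t) for all t ∈ [0,T]; (2) z_k(t) ⇀ z(t) in Z for all t ∈ [0,T]; and (3) Var(D, z; [t₀, t₁]) ≤ Δ(t₁) − Δ(t₀) for all 0 ≤ t₀ < t₁ ≤ T. -/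
open Filter Topology
open scoped ENNReal

/-- The total variation (dissipation) of `z : ℝ → Z` on `[a,b]` with respect to
`D : Z × Z → [0,∞]`: the supremum of `Σ D(z(t_{i-1}), z(t_i))` over all finite
partitions `a = t_0 < t_1 < ⋯ < t_N = b`. -/
noncomputable def Var {Z : Type*} (D : Z → Z → ℝ≥0∞) (z : ℝ → Z) (a b : ℝ) : ℝ≥0∞ :=
  ⨆ (N : ℕ) (t : ℕ → ℝ) (_ : t 0 = a ∧ t N = b ∧ ∀ k < N, t k < t (k + 1)),
    ∑ i ∈ Finset.range N, D (z (t i)) (z (t (i + 1)))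

/-- Weak convergence of a sequence in a normed space, tested against all continuous
linear functionals. -/
def WeakConv {Z : Type*} [NormedAddCommGroup Z] [NormedSpace ℝ Z]
    (x : ℕ → Z) (l : Z) : Prop :=
  ∀ f : Z →L[ℝ] ℝ, Tendsto (fun k => f (x k)) atTop (𝓝 (f l))

section HellyAux

theorem helly_diag {Z : Type*} [NormedAddCommGroup Z] [NormedSpace ℝ Z] (K : Set Z)
    (hK : ∀ x : ℕ → Z, (∀ k, x k ∈ K) →
      ∃ φ : ℕ → ℕ, StrictMono φ ∧ ∃ l ∈ K, WeakConv (x ∘ φ) l)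
    (x : ℕ → ℕ → Z) (hx : ∀ n k, x n k ∈ K) :
    ∃ δ : ℕ → ℕ, StrictMono δ ∧ ∀ n, ∃ l ∈ K, WeakConv (x n ∘ δ) l := by
  have h : ∀ (n : ℕ) (φ : ℕ → ℕ), ∃ ψ : ℕ → ℕ, StrictMono ψ ∧
      ∃ l ∈ K, WeakConv (x n ∘ φ ∘ ψ) l := fun n φ =>
    hK (x n ∘ φ) (fun k => hx n _)
  choose ψ hψ l hl hw using h
  let Φ : ℕ → ℕ → ℕ := fun n => Nat.rec id (fun n p => p ∘ ψ n p) n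
  have hΦs : ∀ n, Φ (n + 1) = Φ n ∘ ψ n (Φ n) := fun n => rfl
  have hΦm : ∀ n, StrictMono (Φ n) := by
    intro n
    induction n with
    | zero => exact strictMono_id
    | succ n ih => rw [hΦs]; exact ih.comp (hψ _ _)
  have hθ : ∀ n m, ∃ θ : ℕ → ℕ, StrictMono θ ∧ Φ (n + m) = Φ n ∘ θ := by
    intro n m
    induction m with
    | zero => exact ⟨id, strictMono_id, rfl⟩
    | succ m ih =>
      obtain ⟨θ, h1, h2⟩ := ih
      refine ⟨θ ∘ ψ (n + m) (Φ (n + m)), h1.comp (hψ _ _), ?_⟩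
      rw [← add_assoc, hΦs, ← Function.comp_assoc, ← h2]
  refine ⟨fun n => Φ n n, ?_, ?_⟩
  · refine strictMono_nat_of_lt_succ fun n => ?_
    rw [hΦs]
    exact (hΦm n) (lt_of_lt_of_le (Nat.lt_succ_self n) ((hψ n (Φ n)).id_le (n + 1)))
  · intro n
    refine ⟨l n (Φ n), hl _ _, ?_⟩
    have h3 : ∀ k, ∃ j, k ≤ j ∧ (n + 1 ≤ k → Φ k k = Φ (n + 1) j) := by
      intro k
      by_cases hk : n + 1 ≤ k
      · obtain ⟨m, rfl⟩ := Nat.exists_eq_add_of_le hk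
        obtain ⟨θ, h1, h2⟩ := hθ (n + 1) m
        refine ⟨θ (n + 1 + m), h1.id_le _, fun _ => ?_⟩
        conv_lhs => rw [h2]
        rfl
      · exact ⟨k, le_rfl, fun h => absurd h hk⟩
    choose j hj1 hj2 using h3
    intro f
    have := (hw n (Φ n) f).comp (tendsto_atTop_mono hj1 tendsto_id)
    refine this.congr' ?_
    filter_upwards [eventually_ge_atTop (n + 1)] with k hk
    simp only [Function.comp]
    rw [hj2 k hk, hΦs]
    rfl

theorem helly_diag_countable {Z : Type*} [NormedAddCommGroup Z] [NormedSpace ℝ Z] (K : Set Z)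
    (hK : ∀ x : ℕ → Z, (∀ k, x k ∈ K) →
      ∃ φ : ℕ → ℕ, StrictMono φ ∧ ∃ l ∈ K, WeakConv (x ∘ φ) l)
    (S : Set ℝ) (hS : S.Countable) (hne : S.Nonempty)
    (x : ℕ → ℝ → Z) (hx : ∀ k, ∀ t ∈ S, x k t ∈ K) :
    ∃ δ : ℕ → ℕ, StrictMono δ ∧ ∀ t ∈ S, ∃ l ∈ K, WeakConv (fun k => x (δ k) t) l := by
  obtain ⟨e, rfl⟩ := hS.exists_eq_range hne
  obtain ⟨δ, h1, h2⟩ := helly_diag K hK (fun n k => x k (e n)) (fun n k => hx k _ ⟨n, rfl⟩)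
  refine ⟨δ, h1, ?_⟩
  rintro _ ⟨n, rfl⟩
  exact h2 n

/-- Helly's theorem for monotone functions with values in `[0,∞]`. -/
theorem helly_mono (f : ℕ → ℝ → ℝ≥0∞) (hf : ∀ k, Monotone (f k)) :
    ∃ φ : ℕ → ℕ, StrictMono φ ∧ ∃ g : ℝ → ℝ≥0∞, Monotone g ∧
      ∀ t, Tendsto (fun k => f (φ k) t) atTop (𝓝 (g t)) := by
  obtain ⟨a, φ, hφ, ha⟩ := CompactSpace.tendsto_subseq (fun k (q : ℚ) => f k (q : ℝ))
  rw [tendsto_pi_nhds] at ha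
  let L : ℝ → ℝ≥0∞ := fun t => ⨆ (q : ℚ) (_ : (q : ℝ) ≤ t), a q
  have hL : Monotone L := by
    intro s t hst
    refine iSup₂_le fun q hq => ?_
    exact le_iSup₂_of_le q (hq.trans hst) le_rfl
  have ham : Monotone a := by
    intro p q hpq
    exact le_of_tendsto_of_tendsto' (ha p) (ha q) fun k => hf _ (by exact_mod_cast hpq)
  have hLq : ∀ q : ℚ, L q = a q := by
    intro q
    apply le_antisymm
    · refine iSup₂_le fun p hp => ham (by exact_mod_cast hp)
    · exact le_iSup₂_of_le q le_rfl le_rfl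
  have hLc : ∀ t, ContinuousAt L t → Tendsto (fun k => f (φ k) t) atTop (𝓝 (L t)) := by
    intro t ht
    rw [tendsto_order]
    constructor
    · intro b hb
      obtain ⟨ε, hε, h⟩ := Metric.eventually_nhds_iff.1 (ht.eventually (lt_mem_nhds hb))
      obtain ⟨q, hq1, hq2⟩ := exists_rat_btwn (show t - ε < t by linarith)
      have := h (y := (q : ℝ)) (by rw [Real.dist_eq, abs_lt]; constructor <;> linarith)
      rw [hLq] at this
      filter_upwards [(ha q).eventually (lt_mem_nhds this)] with k hk
      exact lt_of_lt_of_le hk (hf _ hq2.le)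
    · intro b hb
      obtain ⟨ε, hε, h⟩ := Metric.eventually_nhds_iff.1 (ht.eventually (gt_mem_nhds hb))
      obtain ⟨q, hq1, hq2⟩ := exists_rat_btwn (show t < t + ε by linarith)
      have := h (y := (q : ℝ)) (by rw [Real.dist_eq, abs_lt]; constructor <;> linarith)
      rw [hLq] at this
      filter_upwards [(ha q).eventually (gt_mem_nhds this)] with k hk
      exact lt_of_le_of_lt (hf _ hq1.le) hk
  have hcount : Set.Countable {t | ¬ ContinuousAt L t} := hL.countable_not_continuousAt
  haveI : Countable {t | ¬ ContinuousAt L t} := hcount.to_subtype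
  obtain ⟨b, ψ, hψ, hb⟩ := CompactSpace.tendsto_subseq
    (fun k (q : {t | ¬ ContinuousAt L t}) => f (φ k) (q : ℝ))
  rw [tendsto_pi_nhds] at hb
  have hex : ∀ t, ∃ c, Tendsto (fun k => f (φ (ψ k)) t) atTop (𝓝 c) := by
    intro t
    by_cases ht : ContinuousAt L t
    · exact ⟨_, (hLc t ht).comp hψ.tendsto_atTop⟩
    · exact ⟨_, hb ⟨t, ht⟩⟩
  choose g hg using hex
  exact ⟨φ ∘ ψ, hφ.comp hψ, g, fun s t hst =>
    le_of_tendsto_of_tendsto' (hg s) (hg t) fun k => hf _ hst, hg⟩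

theorem var_add_le {Z : Type*} (D : Z → Z → ℝ≥0∞) (z : ℝ → Z) (a s t : ℝ) (has : a ≤ s)
    (hst : s < t) : Var D z a s + D (z s) (z t) ≤ Var D z a t := by
  have key : ∀ (N : ℕ) (p : ℕ → ℝ), (p 0 = a ∧ p N = s ∧ ∀ k < N, p k < p (k + 1)) →
      ∑ i ∈ Finset.range N, D (z (p i)) (z (p (i + 1))) + D (z s) (z t) ≤ Var D z a t := by
    rintro N p ⟨h0, hN, hp⟩
    let q : ℕ → ℝ := fun i => if i ≤ N then p i else t
    have hq1 : ∀ i, i ≤ N → q i = p i := fun i hi => if_pos hi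
    have hq2 : q (N + 1) = t := if_neg (by omega)
    have hq : q 0 = a ∧ q (N + 1) = t ∧ ∀ k < N + 1, q k < q (k + 1) := by
      refine ⟨by rw [hq1 0 (Nat.zero_le _), h0], hq2, fun k hk => ?_⟩
      rcases Nat.lt_succ_iff_lt_or_eq.1 hk with h | h
      · rw [hq1 k h.le, hq1 (k + 1) h]; exact hp k h
      · rw [h, hq2, hq1 N le_rfl, hN]; exact hst
    have hle : ∑ i ∈ Finset.range (N + 1), D (z (q i)) (z (q (i + 1))) ≤ Var D z a t :=
      le_iSup_of_le (N + 1) (le_iSup_of_le q (le_iSup_of_le hq le_rfl))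
    rw [Finset.sum_range_succ, hq2, hq1 N le_rfl, hN] at hle
    refine le_trans (le_of_eq ?_) hle
    congr 1
    refine Finset.sum_congr rfl fun i hi => ?_
    have := Finset.mem_range.1 hi
    rw [hq1 i this.le, hq1 (i + 1) this]
  have hD : D (z s) (z t) ≤ Var D z a t := by
    rcases has.eq_or_lt with h | h
    · have := key 0 (fun _ => s) ⟨h.symm, rfl, by simp⟩
      simpa using this
    · have := key 1 (fun i => if i = 0 then a else s) ⟨rfl, rfl, by
        intro k hk
        obtain rfl : k = 0 := by omega
        simpa using h⟩
      exact le_trans le_add_self this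
  by_cases htop : D (z s) (z t) = ⊤
  · rw [htop] at hD ⊢; simpa using hD
  have : Var D z a s ≤ Var D z a t - D (z s) (z t) := by
    refine iSup_le fun N => iSup_le fun p => iSup_le fun hp => ?_
    exact ENNReal.le_sub_of_add_le_right htop (key N p hp)
  calc _ ≤ (Var D z a t - D (z s) (z t)) + D (z s) (z t) := by gcongr
    _ = _ := tsub_add_cancel_of_le hD

theorem bounded_of_wsc {Z : Type*} [NormedAddCommGroup Z] [NormedSpace ℝ Z] (K : Set Z)
    (hK : ∀ x : ℕ → Z, (∀ k, x k ∈ K) →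
      ∃ φ : ℕ → ℕ, StrictMono φ ∧ ∃ l ∈ K, WeakConv (x ∘ φ) l) :
    ∃ R : ℝ, ∀ x ∈ K, ‖x‖ ≤ R := by
  by_contra! h
  choose x hxK hx using fun n : ℕ => h n
  obtain ⟨φ, hφ, l, -, hw⟩ := hK x hxK
  obtain ⟨M, hM⟩ := banach_steinhaus
    (g := fun k => NormedSpace.inclusionInDoubleDual ℝ Z (x (φ k))) (fun f => by
      obtain ⟨B, hB⟩ := (hw f).norm.bddAbove_range
      exact ⟨B, fun k => hB ⟨k, rfl⟩⟩)
  obtain ⟨n, hn⟩ := exists_nat_gt M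
  have h1 := hM n
  have h2 : ‖NormedSpace.inclusionInDoubleDual ℝ Z (x (φ n))‖ = ‖x (φ n)‖ :=
    (NormedSpace.inclusionInDoubleDualLi ℝ (E := Z)).norm_map (x (φ n))
  have h3 := hx (φ n)
  have h4 : (n : ℝ) ≤ φ n := by exact_mod_cast hφ.id_le n
  linarith

end HellyAux

/-- Generalized Helly selection principle: given a weakly sequentially compact `K` in a
Banach space `Z` and a dissipation distance `D` which is weakly lower semicontinuous,
positive, vanishing exactly on the diagonal and satisfying the triangle inequality, every
sequence `z_k : [0,T] → K` of uniformly bounded `D`-variation admits a subsequence, a limit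
function `z : [0,T] → K` and a nondecreasing `Δ : [0,T] → [0,C]` such that the variations
of `z_k` on `[0,t]` converge to `Δ(t)`, `z_k(t) ⇀ z(t)` for every `t`, and
`Var(D, z; [t₀,t₁]) ≤ Δ(t₁) - Δ(t₀)`. -/
theorem helly_selection_principle {Z : Type*} [NormedAddCommGroup Z] [NormedSpace ℝ Z]
    [CompleteSpace Z] (K : Set Z)
    (hK : ∀ x : ℕ → Z, (∀ k, x k ∈ K) →
      ∃ φ : ℕ → ℕ, StrictMono φ ∧ ∃ l ∈ K, WeakConv (x ∘ φ) l)
    (D : Z → Z → ℝ≥0∞)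
    (hlsc : ∀ (z' z'' : ℕ → Z) (w w' : Z), WeakConv z' w → WeakConv z'' w' →
      D w w' ≤ liminf (fun k => D (z' k) (z'' k)) atTop)
    (hpos : ∀ (z' : ℕ → Z) (w : Z), (∃ R : ℝ, ∀ k, ‖z' k‖ ≤ R) →
      Tendsto (fun k => min (D (z' k) w) (D w (z' k))) atTop (𝓝 0) → WeakConv z' w)
    (hzero : ∀ z₁ z₂, D z₁ z₂ = 0 ↔ z₁ = z₂)
    (htri : ∀ z₁ z₂ z₃, D z₁ z₃ ≤ D z₁ z₂ + D z₂ z₃)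
    (T : ℝ) (hT : 0 < T) (C : ℝ) (hC : 0 < C)
    (zk : ℕ → ℝ → Z) (hzkK : ∀ k, ∀ t ∈ Set.Icc (0 : ℝ) T, zk k t ∈ K)
    (hvar : (⨆ k, Var D (zk k) 0 T) < ENNReal.ofReal C) :
    ∃ φ : ℕ → ℕ, StrictMono φ ∧
      ∃ (z : ℝ → Z) (Δ : ℝ → ℝ≥0∞),
        (∀ t ∈ Set.Icc (0 : ℝ) T, z t ∈ K) ∧
        (∀ t ∈ Set.Icc (0 : ℝ) T, Δ t ≤ ENNReal.ofReal C) ∧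
        MonotoneOn Δ (Set.Icc (0 : ℝ) T) ∧
        (∀ t ∈ Set.Icc (0 : ℝ) T,
          Tendsto (fun j => Var D (zk (φ j)) 0 t) atTop (𝓝 (Δ t))) ∧
        (∀ t ∈ Set.Icc (0 : ℝ) T, WeakConv (fun j => zk (φ j) t) (z t)) ∧
        (∀ t₀ t₁ : ℝ, 0 ≤ t₀ → t₀ < t₁ → t₁ ≤ T → Var D z t₀ t₁ ≤ Δ t₁ - Δ t₀) := by
  have hCtop : ENNReal.ofReal C ≠ ⊤ := ENNReal.ofReal_ne_top
  have hvT : ∀ k, Var D (zk k) 0 T ≤ ENNReal.ofReal C := fun k =>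
    (le_iSup (fun k => Var D (zk k) 0 T) k).trans hvar.le
  have hvmono : ∀ k s t, 0 ≤ s → s ≤ t → Var D (zk k) 0 s ≤ Var D (zk k) 0 t := by
    intro k s t hs hst
    rcases hst.eq_or_lt with rfl | h
    · exact le_rfl
    · exact le_self_add.trans (var_add_le D (zk k) 0 s t hs h)
  let P : ℝ → ℝ := fun t => max 0 (min T t)
  have hPm : Monotone P := fun s t hst => max_le_max le_rfl (min_le_min le_rfl hst)
  have hP : ∀ t ∈ Set.Icc (0 : ℝ) T, P t = t := fun t ht => by
    simp only [P]; rw [min_eq_right ht.2, max_eq_right ht.1]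
  obtain ⟨φ, hφ, Δ, hΔm, hΔ'⟩ := helly_mono (fun k t => Var D (zk k) 0 (P t))
    (fun k s t hst => hvmono k _ _ (le_max_left _ _) (hPm hst))
  have hΔ : ∀ t ∈ Set.Icc (0 : ℝ) T,
      Tendsto (fun k => Var D (zk (φ k)) 0 t) atTop (𝓝 (Δ t)) := by
    intro t ht
    have := hΔ' t
    simpa only [hP t ht] using this
  have hΔC : ∀ t ∈ Set.Icc (0 : ℝ) T, Δ t ≤ ENNReal.ofReal C := fun t ht =>
    le_of_tendsto' (hΔ t ht) fun k => (hvmono _ t T ht.1 ht.2).trans (hvT _)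
  have hΔtop : ∀ t ∈ Set.Icc (0 : ℝ) T, Δ t ≠ ⊤ := fun t ht =>
    ne_top_of_le_ne_top hCtop (hΔC t ht)
  -- the key estimate
  have key : ∀ (τ : ℕ → ℕ), Tendsto τ atTop atTop → ∀ s ∈ Set.Icc (0 : ℝ) T,
      ∀ t ∈ Set.Icc (0 : ℝ) T, s < t → ∀ w w', WeakConv (fun j => zk (φ (τ j)) s) w →
      WeakConv (fun j => zk (φ (τ j)) t) w' → D w w' ≤ Δ t - Δ s := by
    intro τ hτ s hs t ht hst w w' hw hw'
    refine (hlsc _ _ _ _ hw hw').trans ?_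
    have hlim : Tendsto (fun j => Var D (zk (φ (τ j))) 0 t - Var D (zk (φ (τ j))) 0 s) atTop
        (𝓝 (Δ t - Δ s)) :=
      ENNReal.Tendsto.sub ((hΔ t ht).comp hτ) ((hΔ s hs).comp hτ) (Or.inl (hΔtop t ht))
    rw [← hlim.liminf_eq]
    refine liminf_le_liminf (Eventually.of_forall fun j => ?_)
    refine ENNReal.le_sub_of_add_le_left ?_ (var_add_le D _ 0 s t hs.1 hst)
    exact ne_top_of_le_ne_top hCtop ((hvmono _ s T hs.1 hs.2).trans (hvT _))
  let S : Set ℝ := Set.Icc (0 : ℝ) T ∩ (Set.range ((↑) : ℚ → ℝ) ∪ {t | ¬ ContinuousAt Δ t})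
  have hSc : S.Countable :=
    ((Set.countable_range _).union hΔm.countable_not_continuousAt).mono Set.inter_subset_right
  have hS0 : (0 : ℝ) ∈ S := ⟨⟨le_rfl, hT.le⟩, Or.inl ⟨0, by simp⟩⟩
  obtain ⟨δ, hδ, hδS⟩ := helly_diag_countable K hK S hSc ⟨0, hS0⟩ (fun k => zk (φ k))
    (fun k t ht => hzkK _ t ht.1)
  choose! zS hzSK hzS using hδS
  obtain ⟨R, hR⟩ := bounded_of_wsc K hK
  have hall : ∀ t ∈ Set.Icc (0 : ℝ) T, ∃ l ∈ K, WeakConv (fun k => zk (φ (δ k)) t) l := by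
    intro t ht
    by_cases htS : t ∈ S
    · exact ⟨zS t, hzSK t htS, hzS t htS⟩
    have hcont : ContinuousAt Δ t := by
      by_contra h
      exact htS ⟨ht, Or.inr h⟩
    have ht0 : 0 < t := lt_of_le_of_ne ht.1 (fun h => htS (h ▸ hS0))
    have hq : ∀ n : ℕ, ∃ q : ℚ, max 0 (t - 1 / ((n : ℝ) + 1)) < q ∧ (q : ℝ) < t := fun n =>
      exists_rat_btwn (max_lt ht0 (by
        have : (0 : ℝ) < 1 / ((n : ℝ) + 1) := by positivity
        linarith))
    choose q hq1 hq2 using hq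
    have hqI : ∀ n, (q n : ℝ) ∈ Set.Icc (0 : ℝ) T := fun n =>
      ⟨((le_max_left _ _).trans_lt (hq1 n)).le, (hq2 n).le.trans ht.2⟩
    have hqS : ∀ n, (q n : ℝ) ∈ S := fun n => ⟨hqI n, Or.inl ⟨q n, rfl⟩⟩
    have hqt : Tendsto (fun n => (q n : ℝ)) atTop (𝓝 t) := by
      refine tendsto_of_tendsto_of_tendsto_of_le_of_le
        (g := fun n : ℕ => t - 1 / ((n : ℝ) + 1)) (h := fun _ => t) ?_ tendsto_const_nhds
        (fun n => ((le_max_right _ _).trans_lt (hq1 n)).le) (fun n => (hq2 n).le)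
      simpa using (tendsto_const_nhds (x := t)).sub
        (tendsto_one_div_add_atTop_nhds_zero_nat (𝕜 := ℝ))
    have hlim0 : Tendsto (fun n => Δ t - Δ (q n)) atTop (𝓝 0) := by
      have := ENNReal.Tendsto.sub (tendsto_const_nhds (x := Δ t) (f := atTop))
        (hcont.tendsto.comp hqt) (Or.inl (hΔtop t ht))
      simpa using this
    have huniq : ∀ τ : ℕ → ℕ, Tendsto τ atTop atTop → ∀ w,
        WeakConv (fun j => zk (φ (δ (τ j))) t) w → WeakConv (fun n => zS (q n)) w := by
      intro τ hτ w hw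
      refine hpos _ _ ⟨R, fun n => hR _ (hzSK _ (hqS n))⟩ ?_
      refine tendsto_of_tendsto_of_tendsto_of_le_of_le tendsto_const_nhds hlim0
        (fun n => zero_le) (fun n => (min_le_left _ _).trans ?_)
      exact key (δ ∘ τ) (hδ.tendsto_atTop.comp hτ) (q n) (hqI n) t ht (hq2 n) _ _
        (fun f => (hzS _ (hqS n) f).comp hτ) hw
    obtain ⟨ψ, hψ, l, hl, hlw⟩ := hK (fun k => zk (φ (δ k)) t) (fun k => hzkK _ t ht)
    refine ⟨l, hl, fun f => ?_⟩
    have h1 := huniq ψ hψ.tendsto_atTop l hlw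
    refine tendsto_of_subseq_tendsto fun ns hns => ?_
    obtain ⟨ms, hms, w, -, hww⟩ := hK (fun k => zk (φ (δ (ns k))) t) (fun k => hzkK _ t ht)
    have h2 := huniq (ns ∘ ms) (hns.comp hms.tendsto_atTop) w hww
    refine ⟨ms, ?_⟩
    rw [tendsto_nhds_unique (h1 f) (h2 f)]
    exact hww f
  choose! z hzK hz using hall
  refine ⟨φ ∘ δ, hφ.comp hδ, z, Δ, hzK, hΔC, hΔm.monotoneOn _,
    fun t ht => (hΔ t ht).comp hδ.tendsto_atTop, hz, ?_⟩
  intro t₀ t₁ h0 h01 h1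
  refine iSup_le fun N => iSup_le fun p => iSup_le fun ⟨hp0, hpN, hp⟩ => ?_
  refine ENNReal.le_sub_of_add_le_left (hΔtop t₀ ⟨h0, h01.le.trans h1⟩) ?_
  have hpm : ∀ i j, i ≤ j → j ≤ N → p i ≤ p j := by
    intro i j hij
    induction j, hij using Nat.le_induction with
    | base => intro _; exact le_rfl
    | succ j _ ih => intro hj; exact (ih (by omega)).trans (hp j (by omega)).le
  have hpI : ∀ i, i ≤ N → p i ∈ Set.Icc (0 : ℝ) T := fun i hi =>
    ⟨h0.trans (hp0 ▸ hpm 0 i (Nat.zero_le _) hi), (hpm i N hi le_rfl).trans (hpN ▸ h1)⟩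
  have hind : ∀ n, n ≤ N →
      Δ t₀ + ∑ i ∈ Finset.range n, D (z (p i)) (z (p (i + 1))) ≤ Δ (p n) := by
    intro n
    induction n with
    | zero => intro _; simp [hp0]
    | succ n ih =>
      intro hn
      rw [Finset.sum_range_succ, ← add_assoc]
      have hk := key δ hδ.tendsto_atTop (p n) (hpI n (by omega)) (p (n + 1)) (hpI _ hn)
        (hp n (by omega)) _ _ (hz _ (hpI n (by omega))) (hz _ (hpI _ hn))
      calc _ ≤ Δ (p n) + (Δ (p (n + 1)) - Δ (p n)) := add_le_add (ih (by omega)) hk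
        _ = _ := add_tsub_cancel_of_le (hΔm (hp n (by omega)).le)
  have := hind N le_rfl
  rwa [hpN] at this
end
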